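/- arXiv:1209.6381 — 2 statements merged into one kernel-verified Lean document; each statement's English description precedes it below -/
import Mathlib

section
/- Let L be a 3-component string link with parameter R > 0. For every ε > 0 there exists T > 0 such that for all i ≠ j in {1,2,3} and all s, t ∈ ℝ with |t| ≥ T, the unit vector u := unit(L(j,s) − L(i,t)) satisfies: if i = 1 then u lies within distance ε of C₊; if i = 2 then u lies within distance ε of C; and if i = 3 then u lies within distance ε of C₋. (Thus when a point on strand 1 escapes to infinity, the Gauss direction from it to any point on another strand degenerates into the closed half-equator C₊; strand 2 gives the equator C, and strand 3 gives C₋.) -/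
noncomputable section

open Metric Set

/-- `E³ = EuclideanSpace ℝ (Fin 3)`. -/
abbrev E3 := EuclideanSpace ℝ (Fin 3)

/-- The vector `(a, b, c)` in `E³`. -/
def mkE3 (a b c : ℝ) : E3 := (WithLp.equiv 2 (Fin 3 → ℝ)).symm ![a, b, c]

/-- `unit(w) = ‖w‖⁻¹ • w`. -/
def unitVec (w : E3) : E3 := ‖w‖⁻¹ • w

/-- `dᵢ⁺`: the unit vector in the direction `(i − (k+1)/2, 1, 0)`, where the components of a
`k`-component string link are indexed by `i = 1, …, k` (so `i : Fin k` stands for `i + 1`). -/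
def dplus (k : ℕ) (i : Fin k) : E3 :=
  unitVec (mkE3 ((i : ℝ) + 1 - ((k : ℝ) + 1) / 2) 1 0)

/-- `dᵢ⁻`: the unit vector in the direction `(i − (k+1)/2, −1, 0)`. -/
def dminus (k : ℕ) (i : Fin k) : E3 :=
  unitVec (mkE3 ((i : ℝ) + 1 - ((k : ℝ) + 1) / 2) (-1) 0)

/-- A `k`-component string link with parameter `R`. -/
def IsStringLink (k : ℕ) (R : ℝ) (L : Fin k × ℝ → E3) : Prop :=
  Continuous L ∧ Function.Injective L ∧
    (∀ i t, |t| ≤ R → ‖L (i, t)‖ ≤ R) ∧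
    (∀ i t, R ≤ t → L (i, t) = t • dplus k i) ∧
    (∀ i t, t ≤ -R → L (i, t) = (-t) • dminus k i)

/-- The unit sphere `S²` in `E³`. -/
def S2 : Set E3 := Metric.sphere 0 1

/-- The equator `C = {v ∈ S² : v 2 = 0}`. -/
def Ceq : Set E3 := {v ∈ S2 | v 2 = 0}

/-- The closed half-equator `C₊ = {v ∈ C : v 0 ≥ 0}`. -/
def Cpos : Set E3 := {v ∈ Ceq | 0 ≤ v 0}

/-- The closed half-equator `C₋ = {v ∈ C : v 0 ≤ 0}`. -/
def Cneg : Set E3 := {v ∈ Ceq | v 0 ≤ 0}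

/-- The closed upper hemisphere `H₊`. -/
def Hpos : Set E3 := {v ∈ S2 | 0 ≤ v 2}

/-- The closed lower hemisphere `H₋`. -/
def Hneg : Set E3 := {v ∈ S2 | v 2 ≤ 0}

theorem norm_unitVec {w : E3} (hw : w ≠ 0) : ‖unitVec w‖ = 1 := by
  rw [unitVec, norm_smul, norm_inv, norm_norm, inv_mul_cancel₀ (norm_ne_zero_iff.2 hw)]

theorem unitVec_apply (w : E3) (n : Fin 3) : unitVec w n = ‖w‖⁻¹ * w n := by
  simp [unitVec]

theorem E3.norm_sq (w : E3) : ‖w‖ ^ 2 = w 0 ^ 2 + w 1 ^ 2 + w 2 ^ 2 := by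
  rw [EuclideanSpace.real_norm_sq_eq, Fin.sum_univ_three]

theorem E3.abs_apply_le_norm (w : E3) (n : Fin 3) : |w n| ≤ ‖w‖ := by
  simpa using PiLp.norm_apply_le w n

/-- The normalized projection to the equator moves a unit vector `u` by at most `2 * |u 2|`. -/
theorem exists_mem_Ceq_dist_le {u : E3} (hu : ‖u‖ = 1) (h2 : |u 2| < 1) :
    ∃ v ∈ Ceq, ∃ c > 0, v 0 = c * u 0 ∧ dist u v ≤ 2 * |u 2| := by
  have hn := E3.norm_sq u
  rw [hu] at hn
  have h2' : u 2 ^ 2 < 1 := (sq_lt_one_iff_abs_lt_one _).2 h2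
  set r := √(u 0 ^ 2 + u 1 ^ 2) with hr
  have hpos : 0 < u 0 ^ 2 + u 1 ^ 2 := by linarith
  have hr0 : 0 < r := Real.sqrt_pos.2 hpos
  have hr2 : r ^ 2 = u 0 ^ 2 + u 1 ^ 2 := Real.sq_sqrt hpos.le
  have hrr : r⁻¹ * r = 1 := inv_mul_cancel₀ hr0.ne'
  have hr1 : r ≤ 1 := by nlinarith [sq_nonneg (u 2)]
  have hv0 : mkE3 (r⁻¹ * u 0) (r⁻¹ * u 1) 0 0 = r⁻¹ * u 0 := by simp [mkE3]
  have hv1 : mkE3 (r⁻¹ * u 0) (r⁻¹ * u 1) 0 1 = r⁻¹ * u 1 := by simp [mkE3]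
  have hv2 : mkE3 (r⁻¹ * u 0) (r⁻¹ * u 1) 0 2 = 0 := by simp [mkE3]
  refine ⟨mkE3 (r⁻¹ * u 0) (r⁻¹ * u 1) 0, ⟨?_, hv2⟩, r⁻¹, inv_pos.2 hr0, hv0, ?_⟩
  · rw [S2, mem_sphere_zero_iff_norm, ← sq_eq_sq₀ (norm_nonneg _) zero_le_one, E3.norm_sq,
      hv0, hv1, hv2]
    linear_combination (-r⁻¹ ^ 2) * hr2 + (r⁻¹ * r + 1) * hrr
  · rw [dist_eq_norm]
    refine abs_le_of_sq_le_sq' ?_ (by positivity) |>.2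
    rw [E3.norm_sq, PiLp.sub_apply, PiLp.sub_apply, PiLp.sub_apply, hv0, hv1, hv2, mul_pow, sq_abs]
    have key : (u 0 - r⁻¹ * u 0) ^ 2 + (u 1 - r⁻¹ * u 1) ^ 2 = (1 - r) ^ 2 := by
      linear_combination (-(1 - r⁻¹) ^ 2) * hr2 + (r⁻¹ * r + 1 - 2 * r) * hrr
    nlinarith

/-- A vector whose height is small compared with its norm has direction close to the equator,
on the same side of the plane `v 0 = 0`. -/
theorem exists_mem_Ceq_dist_unitVec_le {w : E3} {δ : ℝ} (hw : w ≠ 0) (hδ : δ < 1)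
    (h : |w 2| ≤ δ * ‖w‖) :
    ∃ v ∈ Ceq, ∃ c > 0, v 0 = c * w 0 ∧ dist (unitVec w) v ≤ 2 * δ := by
  have hw' : 0 < ‖w‖ := norm_pos_iff.2 hw
  have hu : |unitVec w 2| ≤ δ := by
    rw [unitVec_apply, abs_mul, abs_inv, abs_norm, inv_mul_le_iff₀ hw']
    linarith
  obtain ⟨v, hv, c, hc, hvc, hd⟩ := exists_mem_Ceq_dist_le (norm_unitVec hw) (hu.trans_lt hδ)
  refine ⟨v, hv, c * ‖w‖⁻¹, by positivity, ?_, by linarith⟩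
  rw [hvc, unitVec_apply, mul_assoc]

theorem mkE3_ne_zero {a b c : ℝ} (hb : b ≠ 0) : mkE3 a b c ≠ 0 := by
  intro h
  apply hb
  simpa [mkE3] using congrArg (fun v : E3 => v 1) h

/-- Outside the ball of radius `R`, a string link runs along horizontal rays. -/
theorem IsStringLink.outside {k : ℕ} {R : ℝ} (hR : 0 < R) {L : Fin k × ℝ → E3}
    (hL : IsStringLink k R L) (i : Fin k) {t : ℝ} (ht : R ≤ |t|) :
    ‖L (i, t)‖ = |t| ∧ L (i, t) 2 = 0 ∧
      L (i, t) 0 = |t| * (((i : ℝ) + 1 - ((k : ℝ) + 1) / 2) /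
        √(((i : ℝ) + 1 - ((k : ℝ) + 1) / 2) ^ 2 + 1)) := by
  obtain ⟨-, -, -, hp, hm⟩ := hL
  have main (b : ℝ) (hb : b ^ 2 = 1) (a : ℝ)
      (h : L (i, t) = |t| • unitVec (mkE3 a b 0)) :
      ‖L (i, t)‖ = |t| ∧ L (i, t) 2 = 0 ∧ L (i, t) 0 = |t| * (a / √(a ^ 2 + 1)) := by
    have hb0 : b ≠ 0 := by rintro rfl; norm_num at hb
    have hn : ‖mkE3 a b 0‖ = √(a ^ 2 + 1) := by
      rw [← Real.sqrt_sq (norm_nonneg _), E3.norm_sq]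
      simp [mkE3, hb]
    refine ⟨?_, ?_, ?_⟩
    · rw [h, norm_smul, norm_unitVec (mkE3_ne_zero hb0), Real.norm_eq_abs, abs_abs, mul_one]
    · rw [h, PiLp.smul_apply, unitVec_apply]
      simp [mkE3]
    · rw [h, PiLp.smul_apply, unitVec_apply, hn, smul_eq_mul, div_eq_inv_mul]
      simp [mkE3]
  rcases le_abs.1 ht with h | h
  · exact main 1 (by norm_num) _ (by rw [hp i t h, abs_of_pos (hR.trans_le h), dplus])
  · exact main (-1) (by norm_num) _
      (by rw [hm i t (by linarith), abs_of_neg (by linarith), dminus])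

/-- A string link stays within height `R` of the horizontal plane. -/
theorem IsStringLink.abs_apply_two_le {k : ℕ} {R : ℝ} (hR : 0 < R) {L : Fin k × ℝ → E3}
    (hL : IsStringLink k R L) (i : Fin k) (t : ℝ) : |L (i, t) 2| ≤ R := by
  rcases le_total |t| R with h | h
  · exact (E3.abs_apply_le_norm _ _).trans (hL.2.2.1 i t h)
  · rw [(hL.outside hR i h).2.1, abs_zero]
    exact hR.le

/-- A strand whose ends point to the side `0 ≤ v 0` never goes further than `R` to the other
side. -/
theorem IsStringLink.neg_le_apply_zero {k : ℕ} {R : ℝ} (hR : 0 < R) {L : Fin k × ℝ → E3}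
    (hL : IsStringLink k R L) (i : Fin k) (hi : 0 ≤ (i : ℝ) + 1 - ((k : ℝ) + 1) / 2) (t : ℝ) :
    -R ≤ L (i, t) 0 := by
  rcases le_total |t| R with h | h
  · exact (abs_le.1 ((E3.abs_apply_le_norm _ 0).trans (hL.2.2.1 i t h))).1
  · rw [(hL.outside hR i h).2.2]
    have := mul_nonneg (abs_nonneg t) (div_nonneg hi (Real.sqrt_nonneg
      (((i : ℝ) + 1 - ((k : ℝ) + 1) / 2) ^ 2 + 1)))
    linarith

/-- A strand whose ends point to the side `v 0 ≤ 0` never goes further than `R` to the other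
side. -/
theorem IsStringLink.apply_zero_le {k : ℕ} {R : ℝ} (hR : 0 < R) {L : Fin k × ℝ → E3}
    (hL : IsStringLink k R L) (i : Fin k) (hi : (i : ℝ) + 1 - ((k : ℝ) + 1) / 2 ≤ 0) (t : ℝ) :
    L (i, t) 0 ≤ R := by
  rcases le_total |t| R with h | h
  · exact (abs_le.1 ((E3.abs_apply_le_norm _ 0).trans (hL.2.2.1 i t h))).2
  · rw [(hL.outside hR i h).2.2]
    have := mul_nonpos_of_nonneg_of_nonpos (abs_nonneg t) (div_nonpos_of_nonpos_of_nonneg hi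
      (Real.sqrt_nonneg (((i : ℝ) + 1 - ((k : ℝ) + 1) / 2) ^ 2 + 1)))
    linarith

/-- When a point on strand `i` of a 3-component string link escapes to infinity, the Gauss
direction from it to any point on another strand degenerates into `C₊` (for strand 1),
`C` (for strand 2), or `C₋` (for strand 3).  (Strands are indexed by `Fin 3`, so strand `1`
is `i = 0`, strand `2` is `i = 1`, strand `3` is `i = 2`.) -/
theorem gauss_direction_from_escaping_strand_point
    (R : ℝ) (hR : 0 < R) (L : Fin 3 × ℝ → E3) (hL : IsStringLink 3 R L) :
    ∀ ε > (0 : ℝ), ∃ T > (0 : ℝ), ∀ (i j : Fin 3), i ≠ j → ∀ (s t : ℝ), T ≤ |t| →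
      (i = 0 → Metric.infDist (unitVec (L (j, s) - L (i, t))) Cpos ≤ ε) ∧
      (i = 1 → Metric.infDist (unitVec (L (j, s) - L (i, t))) Ceq ≤ ε) ∧
      (i = 2 → Metric.infDist (unitVec (L (j, s) - L (i, t))) Cneg ≤ ε) := by
  intro ε hε
  set δ := min ε 1 / 2 with hδ
  have hδ0 : 0 < δ := by positivity
  have hδ1 : δ < 1 := by linarith [min_le_right ε 1]
  have hδε : 2 * δ ≤ ε := by linarith [min_le_left ε 1]
  have hq : 0 < R / δ := by positivity
  have hqR : δ * (R / δ) = R := mul_div_cancel₀ R hδ0.ne'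
  have hsqrt : (1 / 2 : ℝ) ≤ 1 / √2 :=
    one_div_le_one_div_of_le (by positivity) (Real.sqrt_le_iff.2 (by norm_num))
  refine ⟨2 * (R / δ + R), by positivity, fun i j hij s t ht => ?_⟩
  have htR : R ≤ |t| := by linarith
  have hw : L (j, s) - L (i, t) ≠ 0 := fun h =>
    hij (congrArg Prod.fst (hL.2.1 (sub_eq_zero.1 h))).symm
  obtain ⟨hp, hp2, hp0⟩ := hL.outside hR i htR
  have hw2 : (L (j, s) - L (i, t)) 2 = L (j, s) 2 := by rw [PiLp.sub_apply, hp2, sub_zero]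
  have hw0 : (L (j, s) - L (i, t)) 0 = L (j, s) 0 - L (i, t) 0 := PiLp.sub_apply ..
  have hq2 := hL.abs_apply_two_le hR j s
  have close (h : R / δ ≤ ‖L (j, s) - L (i, t)‖) :
      |(L (j, s) - L (i, t)) 2| ≤ δ * ‖L (j, s) - L (i, t)‖ := by
    rw [hw2]
    linarith [mul_le_mul_of_nonneg_left h hδ0.le]
  have hside : |t| * (1 / 2) ≤ |t| * (1 / √2) := mul_le_mul_of_nonneg_left hsqrt (abs_nonneg t)
  refine ⟨?_, ?_, ?_⟩
  · rintro rfl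
    have hj : 0 ≤ (j : ℝ) + 1 - (((3 : ℕ) : ℝ) + 1) / 2 := by
      fin_cases j <;> first | exact absurd rfl hij | norm_num
    have hq0 := hL.neg_le_apply_zero hR j hj s
    have hp0' : L (0, t) 0 = -(|t| * (1 / √2)) := by
      rw [hp0]; norm_num; ring
    have hlow : R / δ ≤ (L (j, s) - L (0, t)) 0 := by rw [hw0]; linarith
    obtain ⟨v, hv, c, hc, hvc, hd⟩ := exists_mem_Ceq_dist_unitVec_le hw hδ1
      (close (hlow.trans ((le_abs_self _).trans (E3.abs_apply_le_norm _ 0))))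
    have hv0 : 0 ≤ v 0 := hvc ▸ mul_nonneg hc.le (hq.le.trans hlow)
    exact ((infDist_le_dist_of_mem (show v ∈ Cpos from ⟨hv, hv0⟩)).trans hd).trans hδε
  · rintro rfl
    have hclose : |(L (j, s) - L (1, t)) 2| ≤ δ * ‖L (j, s) - L (1, t)‖ := by
      rcases le_total |s| R with hs | hs
      · apply close
        have h1 := hL.2.2.1 j s hs
        have h2 := norm_sub_norm_le (L (1, t)) (L (j, s))
        rw [norm_sub_rev] at h2
        linarith
      · rw [hw2, (hL.outside hR j hs).2.1, abs_zero]
        positivity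
    obtain ⟨v, hv, -, -, -, hd⟩ := exists_mem_Ceq_dist_unitVec_le hw hδ1 hclose
    exact ((infDist_le_dist_of_mem hv).trans hd).trans hδε
  · rintro rfl
    have hj : (j : ℝ) + 1 - (((3 : ℕ) : ℝ) + 1) / 2 ≤ 0 := by
      fin_cases j <;> first | exact absurd rfl hij | norm_num
    have hq0 := hL.apply_zero_le hR j hj s
    have hp0' : L (2, t) 0 = |t| * (1 / √2) := by
      rw [hp0]; norm_num
    have hlow : R / δ ≤ -(L (j, s) - L (2, t)) 0 := by rw [hw0]; linarith
    obtain ⟨v, hv, c, hc, hvc, hd⟩ := exists_mem_Ceq_dist_unitVec_le hw hδ1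
      (close (hlow.trans ((neg_le_abs _).trans (E3.abs_apply_le_norm _ 0))))
    have hv0 : v 0 ≤ 0 := hvc ▸ mul_nonpos_of_nonneg_of_nonpos hc.le (by linarith)
    exact ((infDist_le_dist_of_mem (show v ∈ Cneg from ⟨hv, hv0⟩)).trans hd).trans hδε
end
end

section
/- Let L be a 2-component string link with parameter R > 0, and let A := {v ∈ S² : v 2 = 0 and v 0 ≥ 0} be the closed half-equator. For every ε > 0 there exists T > 0 such that for all t₁, t₂ ∈ ℝ with max(|t₁|, |t₂|) ≥ T, the Gauss direction unit(L(2,t₂) − L(1,t₁)) lies within distance ε of A. (Thus the Gauss map of a two-component string link sends all configurations near infinity into an arbitrarily small neighborhood of the arc A on a great circle.) -/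
noncomputable section

open Metric Set

/-- The closed half-equator arc `A = {v ∈ S² : v 2 = 0 ∧ v 0 ≥ 0}`. -/
def arcA : Set E3 := {v ∈ S2 | v 2 = 0 ∧ 0 ≤ v 0}

/-- The radial model of the `i`-th strand of a string link: two rays glued at the origin. -/
def radialStrand (k : ℕ) (i : Fin k) (t : ℝ) : E3 :=
  if 0 ≤ t then t • dplus k i else (-t) • dminus k i

lemma norm_unitVec_le (w : E3) : ‖unitVec w‖ ≤ 1 := by
  rw [unitVec, norm_smul, norm_inv, norm_norm]
  exact inv_mul_le_one

lemma norm_smul_unitVec (w : E3) : ‖w‖ • unitVec w = w := by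
  rcases eq_or_ne w 0 with rfl | hw
  · simp
  · rw [unitVec, smul_smul, mul_inv_cancel₀ (norm_ne_zero_iff.2 hw), one_smul]

lemma norm_mul_dist_unitVec_le (w p : E3) :
    ‖p‖ * dist (unitVec w) (unitVec p) ≤ 2 * ‖w - p‖ := by
  have key : ‖p‖ • (unitVec w - unitVec p) = (‖p‖ - ‖w‖) • unitVec w + (w - p) := by
    rw [smul_sub, sub_smul, norm_smul_unitVec, norm_smul_unitVec]
    abel
  have hnorm : ‖p‖ * dist (unitVec w) (unitVec p) = ‖‖p‖ • (unitVec w - unitVec p)‖ := by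
    rw [norm_smul, norm_norm, dist_eq_norm]
  rw [hnorm, key]
  have h1 : ‖(‖p‖ - ‖w‖) • unitVec w‖ ≤ ‖w - p‖ := by
    rw [norm_smul, Real.norm_eq_abs, norm_sub_rev]
    exact (mul_le_of_le_one_right (abs_nonneg _) (norm_unitVec_le w)).trans
      (abs_norm_sub_norm_le p w)
  linarith [norm_add_le ((‖p‖ - ‖w‖) • unitVec w) (w - p)]

lemma norm_radialStrand_le (k : ℕ) (i : Fin k) (t : ℝ) : ‖radialStrand k i t‖ ≤ |t| := by
  unfold radialStrand
  split_ifs <;> rw [norm_smul, Real.norm_eq_abs, ← abs_neg t]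
  · rw [abs_neg]
    exact mul_le_of_le_one_right (abs_nonneg _) (norm_unitVec_le _)
  · exact mul_le_of_le_one_right (abs_nonneg _) (norm_unitVec_le _)

lemma IsStringLink.norm_sub_radialStrand_le {k : ℕ} {R : ℝ} {L : Fin k × ℝ → E3}
    (hL : IsStringLink k R L) (hR : 0 < R) (i : Fin k) (t : ℝ) :
    ‖L (i, t) - radialStrand k i t‖ ≤ 2 * R := by
  obtain ⟨-, -, hin, hpos, hneg⟩ := hL
  by_cases ht : |t| ≤ R
  · linarith [norm_sub_le (L (i, t)) (radialStrand k i t), hin i t ht,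
      norm_radialStrand_le k i t]
  · rcases lt_abs.1 (not_le.1 ht) with h | h
    · rw [hpos i t h.le, radialStrand, if_pos (by linarith), sub_self, norm_zero]
      positivity
    · rw [hneg i t (by linarith), radialStrand, if_neg (by linarith), sub_self, norm_zero]
      positivity

lemma norm_mkE3 (a b c : ℝ) : ‖mkE3 a b c‖ = √(a ^ 2 + b ^ 2 + c ^ 2) := by
  simp [EuclideanSpace.norm_eq, mkE3, Fin.sum_univ_three]

lemma smul_mkE3 (r a b c : ℝ) : r • mkE3 a b c = mkE3 (r * a) (r * b) (r * c) := by
  ext j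
  fin_cases j <;> simp [mkE3]

lemma mkE3_sub_mkE3 (a b c a' b' c' : ℝ) :
    mkE3 a b c - mkE3 a' b' c' = mkE3 (a - a') (b - b') (c - c') := by
  ext j
  fin_cases j <;> simp [mkE3]

lemma radialStrand_two (i : Fin 2) (t : ℝ) :
    radialStrand 2 i t =
      (√(5 / 4))⁻¹ • mkE3 (((i : ℝ) - 1 / 2) * |t|) t 0 := by
  have hi : ((i : ℝ) + 1 - (((2 : ℕ) : ℝ) + 1) / 2) = (i : ℝ) - 1 / 2 := by
    push_cast
    ring
  have hsq : ((i : ℝ) - 1 / 2) ^ 2 = 1 / 4 := by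
    fin_cases i <;> norm_num
  have hn (s : ℝ) (hs : s ^ 2 = 1) : ‖mkE3 ((i : ℝ) - 1 / 2) s 0‖ = √(5 / 4) := by
    rw [norm_mkE3, hsq, hs]
    norm_num
  unfold radialStrand dplus dminus unitVec
  rw [hi, hn 1 (by norm_num), hn (-1) (by norm_num)]
  split_ifs with ht
  · rw [smul_comm, smul_mkE3, abs_of_nonneg ht]
    congr 2 <;> ring
  · rw [smul_comm, smul_mkE3, abs_of_neg (not_le.1 ht)]
    congr 2 <;> ring

lemma unitVec_mem_arcA {p : E3} (h0 : 0 < p 0) (h2 : p 2 = 0) : unitVec p ∈ arcA := by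
  have hp : p ≠ 0 := by
    rintro rfl
    simp at h0
  refine ⟨?_, ?_, ?_⟩
  · rw [S2, mem_sphere_zero_iff_norm, unitVec, norm_smul, norm_inv, norm_norm,
      inv_mul_cancel₀ (norm_ne_zero_iff.2 hp)]
  · simp [unitVec, h2]
  · simp only [unitVec, PiLp.smul_apply, smul_eq_mul]
    positivity

/-- The Gauss map of a two-component string link sends all configurations near infinity into
an arbitrarily small neighborhood of the closed half-equator arc `A`. -/
theorem gauss_map_of_two_component_string_link_near_infinity
    (R : ℝ) (hR : 0 < R) (L : Fin 2 × ℝ → E3) (hL : IsStringLink 2 R L) :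
    ∀ ε > (0 : ℝ), ∃ T > (0 : ℝ), ∀ t₁ t₂ : ℝ, T ≤ max |t₁| |t₂| →
      Metric.infDist (unitVec (L (1, t₂) - L (0, t₁))) arcA ≤ ε := by
  intro ε hε
  have hc : 0 < (√(5 / 4 : ℝ))⁻¹ := by positivity
  set c := (√(5 / 4 : ℝ))⁻¹ with hc_def
  refine ⟨16 * R / (c * ε), by positivity, fun t₁ t₂ hT => ?_⟩
  set p := radialStrand 2 1 t₂ - radialStrand 2 0 t₁ with hp_def
  have hp : p = mkE3 (c * ((|t₁| + |t₂|) / 2)) (c * (t₂ - t₁)) 0 := by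
    rw [hp_def, radialStrand_two, radialStrand_two, ← hc_def, ← smul_sub, mkE3_sub_mkE3, smul_mkE3]
    have hfst : ((((1 : Fin 2) : ℕ) : ℝ) - 1 / 2) * |t₂| - ((((0 : Fin 2) : ℕ) : ℝ) - 1 / 2) * |t₁| =
        (|t₁| + |t₂|) / 2 := by
      norm_num
      ring
    rw [hfst, sub_zero, mul_zero]
  have hp0 : p 0 = c * ((|t₁| + |t₂|) / 2) := by simp [hp, mkE3]
  have hp2 : p 2 = 0 := by simp [hp, mkE3]
  have hmax : max |t₁| |t₂| ≤ |t₁| + |t₂| :=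
    max_le (by linarith [abs_nonneg t₂]) (by linarith [abs_nonneg t₁])
  have hlow : 8 * R / ε ≤ p 0 := by
    calc 8 * R / ε = c * ((16 * R / (c * ε)) / 2) := by field_simp; norm_num
      _ ≤ p 0 := by
        rw [hp0]
        gcongr
        exact hT.trans hmax
  have hpos : 0 < 8 * R / ε := by positivity
  have hnorm : 8 * R / ε ≤ ‖p‖ :=
    hlow.trans ((le_abs_self _).trans (by simpa using PiLp.norm_apply_le p 0))
  have herr : ‖L (1, t₂) - L (0, t₁) - p‖ ≤ 4 * R := by
    rw [hp_def, sub_sub_sub_comm]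
    linarith [norm_sub_le (L (1, t₂) - radialStrand 2 1 t₂) (L (0, t₁) - radialStrand 2 0 t₁),
      hL.norm_sub_radialStrand_le hR 1 t₂, hL.norm_sub_radialStrand_le hR 0 t₁]
  refine (Metric.infDist_le_dist_of_mem (unitVec_mem_arcA (hpos.trans_le hlow) hp2)).trans ?_
  have hdist := norm_mul_dist_unitVec_le (L (1, t₂) - L (0, t₁)) p
  refine le_of_mul_le_mul_left ?_ (hpos.trans_le hnorm)
  calc ‖p‖ * dist (unitVec (L (1, t₂) - L (0, t₁))) (unitVec p) ≤ 8 * R := by linarith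
    _ ≤ ‖p‖ * ε := (div_le_iff₀ hε).1 hnorm
end
end
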